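/- arXiv:1407.5108 — 4 statements merged into one kernel-verified Lean document; each statement's English description precedes it below -/
import Mathlib

section
/- Let (S, m) be a local ring and phi : R1 -> R2 a homomorphism of local S-algebras (where the structure maps and phi are local homomorphisms). Assume that R1 is m-adically complete, that R2 is m-adically separated (for instance R2 Noetherian local), and that the induced map R1/(m R1) -> R2/(m R2) is surjective. Then phi is surjective. -/
open IsLocalRing

/-- Let `(S, m)` be a local ring and `φ : R₁ → R₂` a homomorphism of local `S`-algebras
(the structure maps and `φ` being local homomorphisms). Assume that `R₁` is `m`-adically
complete, that `R₂` is `m`-adically separated, and that the induced map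
`R₁/(m R₁) → R₂/(m R₂)` is surjective. Then `φ` is surjective. -/
theorem stmt_10 {S R1 R2 : Type*} [CommRing S] [IsLocalRing S]
    [CommRing R1] [IsLocalRing R1] [Algebra S R1] [IsLocalHom (algebraMap S R1)]
    [CommRing R2] [IsLocalRing R2] [Algebra S R2] [IsLocalHom (algebraMap S R2)]
    (phi : R1 →ₐ[S] R2) [IsLocalHom phi.toRingHom]
    (hcomplete : IsAdicComplete ((maximalIdeal S).map (algebraMap S R1)) R1)
    (hsep : IsHausdorff ((maximalIdeal S).map (algebraMap S R2)) R2)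
    (hsurj : Function.Surjective
      (Ideal.quotientMap (I := (maximalIdeal S).map (algebraMap S R1))
        ((maximalIdeal S).map (algebraMap S R2)) phi.toRingHom
        (by
          rw [Ideal.map_le_iff_le_comap]
          intro x hx
          simp only [Ideal.mem_comap]
          have : phi.toRingHom (algebraMap S R1 x) = algebraMap S R2 x := phi.commutes x
          rw [this]
          exact Ideal.mem_map_of_mem _ hx))) :
    Function.Surjective phi := by
  have hI : ((maximalIdeal S).map (algebraMap S R1)).map phi.toRingHom =
      (maximalIdeal S).map (algebraMap S R2) := by
    rw [Ideal.map_map]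
    congr 1
    ext x
    exact phi.commutes x
  haveI : IsPrecomplete ((maximalIdeal S).map (algebraMap S R1)) R1 := hcomplete.toIsPrecomplete
  haveI : IsHausdorff (((maximalIdeal S).map (algebraMap S R1)).map phi.toRingHom) R2 := by
    rw [hI]; exact hsep
  refine surjective_of_mk_map_comp_surjective (I := (maximalIdeal S).map (algebraMap S R1))
    phi.toRingHom ?_
  intro y
  obtain ⟨z, rfl⟩ := Ideal.Quotient.mk_surjective y
  obtain ⟨w, hw⟩ := hsurj (Ideal.Quotient.mk _ z)
  obtain ⟨x, rfl⟩ := Ideal.Quotient.mk_surjective w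
  refine ⟨x, ?_⟩
  rw [Ideal.quotientMap_mk, Ideal.Quotient.eq, ← hI] at hw
  rw [RingHom.comp_apply, Ideal.Quotient.eq]
  exact hw
end

section
/- Let (S, m) be a local ring and phi : R1 -> R2 a surjective homomorphism of local S-algebras with R1 Noetherian. Assume that R2 is flat as an S-module and that the induced map R1/(m R1) -> R2/(m R2) is an isomorphism. Then phi is an isomorphism. -/
open IsLocalRing

/-- Let `(S, m)` be a local ring and `φ : R₁ → R₂` a surjective homomorphism of local
`S`-algebras with `R₁` Noetherian. Assume that `R₂` is flat as an `S`-module and that the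
induced map `R₁/(m R₁) → R₂/(m R₂)` is an isomorphism. Then `φ` is an isomorphism. -/
theorem stmt_11 {S R1 R2 : Type*} [CommRing S] [IsLocalRing S]
    [CommRing R1] [IsLocalRing R1] [Algebra S R1] [IsLocalHom (algebraMap S R1)]
    [CommRing R2] [IsLocalRing R2] [Algebra S R2] [IsLocalHom (algebraMap S R2)]
    [IsNoetherianRing R1]
    (phi : R1 →ₐ[S] R2) [IsLocalHom phi.toRingHom]
    (hsurj : Function.Surjective phi)
    (hflat : Module.Flat S R2)
    (hbij : Function.Bijective
      (Ideal.quotientMap (I := (maximalIdeal S).map (algebraMap S R1))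
        ((maximalIdeal S).map (algebraMap S R2)) phi.toRingHom
        (by
          rw [Ideal.map_le_iff_le_comap]
          intro x hx
          simp only [Ideal.mem_comap]
          have : phi.toRingHom (algebraMap S R1 x) = algebraMap S R2 x := phi.commutes x
          rw [this]
          exact Ideal.mem_map_of_mem _ hx))) :
    Function.Bijective phi := by
  refine ⟨?_, hsurj⟩
  have hK : RingHom.ker phi.toRingHom = ⊥ := by
    refine Submodule.eq_bot_of_le_smul_of_le_jacobson_bot
      ((maximalIdeal S).map (algebraMap S R1)) _ (IsNoetherian.noetherian _) ?_ ?_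
    · intro x hx
      have hx0 : phi x = 0 := hx
      have hxm : x ∈ (maximalIdeal S).map (algebraMap S R1) := by
        rw [← Ideal.Quotient.eq_zero_iff_mem]
        apply hbij.1
        rw [Ideal.quotientMap_mk, map_zero]
        change Ideal.Quotient.mk _ (phi x) = 0
        rw [hx0, map_zero]
      obtain ⟨t, ht, c, hc⟩ := (Submodule.mem_span_image_iff_exists_fun R1).1 hxm
      have hrel : ∑ i : t, (i : S) • phi (c i) = 0 := by
        rw [← hx0, ← hc, map_sum]
        refine Finset.sum_congr rfl fun i _ => ?_
        rw [smul_eq_mul, map_mul, AlgHom.commutes, Algebra.smul_def, mul_comm]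
      obtain ⟨l, a, y, hay, hfa⟩ := Module.Flat.isTrivialRelation_of_sum_smul_eq_zero
        (R := S) (M := R2) (f := fun i : t => (i : S)) (x := fun i => phi (c i)) hrel
      choose z hz using fun j => hsurj (y j)
      have key : x = ∑ i : t, algebraMap S R1 i • (c i - ∑ j, a i j • z j) := by
        simp only [smul_sub, Finset.sum_sub_distrib, Finset.smul_sum]
        rw [Finset.sum_comm]
        have h0 : ∀ j, ∑ i : t, algebraMap S R1 (i : S) • a i j • z j = 0 := by
          intro j
          simp only [algebraMap_smul, smul_smul]
          rw [← Finset.sum_smul, hfa, zero_smul]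
        simp only [h0, Finset.sum_const_zero, sub_zero]
        rw [← hc]
        exact Finset.sum_congr rfl fun i _ => by simp [mul_comm]
      rw [key]
      refine Submodule.sum_mem _ fun i _ => Submodule.smul_mem_smul
        (Ideal.mem_map_of_mem _ (ht i.2)) ?_
      change phi _ = 0
      rw [map_sub, map_sum, sub_eq_zero]
      refine (hay i).trans ?_
      exact Finset.sum_congr rfl fun j _ => by rw [map_smul, hz]
    · rw [IsLocalRing.jacobson_eq_maximalIdeal _ bot_ne_top]
      have hl : IsLocalHom (algebraMap S R1) := inferInstance
      exact ((IsLocalRing.local_hom_TFAE (algebraMap S R1)).out 0 2 rfl rfl).1 hl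
  exact (RingHom.injective_iff_ker_eq_bot phi.toRingHom).2 hK
end

section
/- Let (R, m) be a complete Noetherian local ring and (S, n) a Noetherian regular local ring equipped with a local ring homomorphism phi : R -> S. Then phi is an isomorphism if and only if both induced maps R/m -> S/n and m/m^2 -> n/n^2 are isomorphisms. -/
open IsLocalRing

/-- The map on cotangent spaces `m/m² → n/n²` induced by a local homomorphism of
local rings. -/
noncomputable def cotangentMapOf {R S : Type*} [CommRing R] [IsLocalRing R] [CommRing S]
    [IsLocalRing S] (phi : R →+* S) [IsLocalHom phi] :
    (maximalIdeal R).Cotangent →+ (maximalIdeal S).Cotangent :=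
  (Ideal.mapCotangent (maximalIdeal R) (maximalIdeal S) phi.toIntAlgHom
    (fun x hx => by
      simp only [Ideal.mem_comap, mem_maximalIdeal, mem_nonunits_iff] at *
      exact fun hu => hx (IsLocalHom.map_nonunit (f := phi) x hu))).toAddMonoidHom

/-- A Noetherian local ring `(S, n)` is regular if it is Noetherian and its Krull
dimension equals the dimension of the cotangent space `n/n²` over the residue field. -/
def IsRegularLocalRingP (S : Type*) [CommRing S] [IsLocalRing S] : Prop :=
  IsNoetherianRing S ∧
    ringKrullDim S = Module.finrank (ResidueField S) (CotangentSpace S)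

theorem aux_wb (d : ℕ) (a : WithBot ℕ∞) (h : (d : WithBot ℕ∞) + 1 ≤ a + 1) :
    (d : WithBot ℕ∞) ≤ a :=
  (ENat.WithBot.add_le_add_one_right_iff).1 h

theorem aux_exchange {R : Type*} [CommRing R] [IsLocalRing R] (s : Finset R)
    (hs : Ideal.span (s : Set R) = maximalIdeal R) (x : R) (hx : x ∈ maximalIdeal R)
    (hx2 : x ∉ maximalIdeal R ^ 2) :
    ∃ t : Finset R, t.card + 1 = s.card ∧
      Ideal.span (t : Set R) ≤ maximalIdeal R ∧
      maximalIdeal R ≤ Ideal.span {x} ⊔ Ideal.span (t : Set R) := by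
  classical
  have hx' := hx
  rw [← hs] at hx'
  obtain ⟨f, -, hf⟩ := Submodule.mem_span_finset.1 hx'
  have hsm : ∀ a ∈ s, a ∈ maximalIdeal R := fun a ha => by
    rw [← hs]; exact Ideal.subset_span ha
  have : ∃ a ∈ s, IsUnit (f a) := by
    by_contra! h
    apply hx2
    rw [← hf, pow_two]
    refine Ideal.sum_mem _ fun a ha => ?_
    exact Ideal.mul_mem_mul ((mem_maximalIdeal _).2 (h a ha)) (hsm a ha)
  obtain ⟨a, ha, hu⟩ := this
  refine ⟨s.erase a, Finset.card_erase_add_one ha,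
    Ideal.span_le.2 fun c hc => hsm c (Finset.mem_of_mem_erase hc), ?_⟩
  rw [← hs, Ideal.span_le]
  intro b hb
  have hmem : ∀ c ∈ s.erase a, c ∈ Ideal.span {x} ⊔ Ideal.span ((s.erase a : Finset R) : Set R) :=
    fun c hc => Ideal.mem_sup_right (Ideal.subset_span hc)
  by_cases hba : b = a
  · subst hba
    have h1 : f b * b = x - ∑ c ∈ s.erase b, f c • c := by
      rw [← hf, ← Finset.add_sum_erase s _ ha]; simp
    have h2 : f b * b ∈ Ideal.span {x} ⊔ Ideal.span ((s.erase b : Finset R) : Set R) := by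
      rw [h1]
      refine sub_mem (Ideal.mem_sup_left (Ideal.mem_span_singleton_self x)) ?_
      exact Ideal.sum_mem _ fun c hc => Ideal.mul_mem_left _ _ (hmem c hc)
    exact (Ideal.unit_mul_mem_iff_mem _ hu).1 h2
  · exact hmem b (Finset.mem_erase.2 ⟨hba, hb⟩)

theorem aux_domain (d : ℕ) : ∀ (R : Type*) [CommRing R] [IsLocalRing R] [IsNoetherianRing R]
    (s : Finset R), Ideal.span (s : Set R) = maximalIdeal R → s.card = d →
    (d : WithBot ℕ∞) ≤ ringKrullDim R → IsDomain R := by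
  classical
  induction d with
  | zero =>
    intro R _ _ _ s hs hc _
    rw [Finset.card_eq_zero] at hc
    subst hc
    have : maximalIdeal R = ⊥ := by rw [← hs]; simp
    exact (isField_iff_maximalIdeal_eq.2 this).isDomain
  | succ d ih =>
    intro R _ _ _ s hs hc hd
    have hmin : maximalIdeal R ∉ minimalPrimes R := by
      intro h
      rw [← Ideal.height_eq_zero_iff] at h
      rw [← maximalIdeal_height_eq_ringKrullDim, h] at hd
      have : ((d + 1 : ℕ) : WithBot ℕ∞) ≤ ((0 : ℕ) : WithBot ℕ∞) := hd
      have := Nat.cast_le.1 this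
      omega
    have hsq : ¬ maximalIdeal R ≤ maximalIdeal R ^ 2 := by
      intro h
      apply hmin
      have hb : maximalIdeal R = ⊥ :=
        Submodule.eq_bot_of_le_smul_of_le_jacobson_bot (maximalIdeal R) (maximalIdeal R)
          (IsNoetherian.noetherian _) (by rwa [smul_eq_mul, ← pow_two])
          (maximalIdeal_le_jacobson _)
      exact ⟨⟨inferInstance, bot_le⟩, fun q _ _ => by rw [hb]; exact bot_le⟩
    have hfin := minimalPrimes.finite_of_isNoetherianRing R
    have hav : ¬ ((maximalIdeal R : Set R) ⊆
        ⋃ i ∈ (↑(insert (maximalIdeal R ^ 2) hfin.toFinset) : Set (Ideal R)), (id i : Ideal R)) := by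
      rw [Ideal.subset_union_prime (maximalIdeal R ^ 2) (maximalIdeal R ^ 2)]
      · rintro ⟨i, hi, hle⟩
        rw [Finset.mem_insert, Set.Finite.mem_toFinset] at hi
        rcases hi with rfl | hi
        · exact hsq hle
        · have hp : i.IsPrime := hi.1.1
          have : maximalIdeal R = i := le_antisymm hle (le_maximalIdeal hp.ne_top)
          exact hmin (this ▸ hi)
      · intro i hi h1 _
        rw [Finset.mem_insert, Set.Finite.mem_toFinset] at hi
        exact (hi.resolve_left h1).1.1
    obtain ⟨x, hx, hxn⟩ := Set.not_subset.1 hav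
    simp only [Finset.coe_insert, Set.Finite.coe_toFinset, Set.mem_insert_iff, Set.mem_iUnion,
      not_exists, id, SetLike.mem_coe] at hxn hx
    have hx2 : x ∉ maximalIdeal R ^ 2 := hxn _ (Or.inl rfl)
    have hxp : ∀ p ∈ minimalPrimes R, x ∉ p := fun p hp => hxn p (Or.inr hp)
    obtain ⟨t, htc, htle, ht⟩ := aux_exchange s hs x hx hx2
    have hne : Ideal.span {x} ≠ (⊤ : Ideal R) := fun h =>
      hx (Ideal.span_singleton_eq_top.1 h)
    have : Nontrivial (R ⧸ Ideal.span {x}) := Ideal.Quotient.nontrivial_iff.2 hne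
    have hsurj := Ideal.Quotient.mk_surjective (I := Ideal.span {x})
    have : IsLocalRing (R ⧸ Ideal.span {x}) := IsLocalRing.of_surjective' _ hsurj
    have hmap := map_maximalIdeal_of_surjective _ hsurj
    have htm : Ideal.span ((Ideal.Quotient.mk (Ideal.span {x})) '' (t : Set R)) ⊔ ⊥ ≥
        maximalIdeal (R ⧸ Ideal.span {x}) := by
      rw [← hmap]
      refine (Ideal.map_mono ht).trans ?_
      rw [Ideal.map_sup, Ideal.map_quotient_self, Ideal.map_span]
      simp
    rw [sup_bot_eq] at htm
    have hdim : ((d : ℕ) : WithBot ℕ∞) ≤ ringKrullDim (R ⧸ Ideal.span {x}) := by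
      have h1 := ringKrullDim_le_ringKrullDim_quotient_add_encard ({x} : Set R) (by
        rw [IsLocalRing.ringJacobson_eq_maximalIdeal]; simpa using hx)
      have h2 := hd.trans h1
      simp only [Set.encard_singleton, WithBot.coe_one, Nat.cast_one, Nat.cast_add] at h2
      exact aux_wb _ _ h2
    have hsp : Ideal.span (((t.image (Ideal.Quotient.mk (Ideal.span {x})) :
        Finset (R ⧸ Ideal.span {x}))) : Set (R ⧸ Ideal.span {x})) = maximalIdeal _ := by
      rw [Finset.coe_image]
      refine le_antisymm ?_ htm
      rw [← hmap, ← Ideal.map_span]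
      exact Ideal.map_mono htle
    have hdim2 : ringKrullDim (R ⧸ Ideal.span {x}) ≤
        ((t.image (Ideal.Quotient.mk (Ideal.span {x}))).card : WithBot ℕ∞) := by
      refine (ringKrullDim_le_spanFinrank_maximalIdeal _).trans ?_
      rw [← hsp]
      have := Submodule.spanFinrank_span_le_ncard_of_finite (R := R ⧸ Ideal.span {x})
        (s := ((t.image (Ideal.Quotient.mk (Ideal.span {x})) : Finset _) :
          Set (R ⧸ Ideal.span {x}))) (Finset.finite_toSet _)
      rw [Set.ncard_coe_finset] at this
      exact_mod_cast this
    have hcd : (t.image (Ideal.Quotient.mk (Ideal.span {x}))).card = d := by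
      have h1 := Nat.cast_le.1 (hdim.trans hdim2)
      have h2 := Finset.card_image_le (s := t) (f := Ideal.Quotient.mk (Ideal.span {x}))
      omega
    have hdom := ih (R ⧸ Ideal.span {x}) _ hsp hcd hdim
    have hprime : (Ideal.span {x}).IsPrime := (Ideal.Quotient.isDomain_iff_prime _).1 hdom
    obtain ⟨P, hP, hPx⟩ := Ideal.exists_minimalPrimes_le (bot_le : ⊥ ≤ Ideal.span {x})
    have hPp : P.IsPrime := hP.1.1
    have hPbot : P = ⊥ := by
      refine Submodule.eq_bot_of_le_smul_of_le_jacobson_bot (maximalIdeal R) P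
          (IsNoetherian.noetherian _) ?_ (maximalIdeal_le_jacobson _)
      intro y hy
      obtain ⟨a, rfl⟩ := Ideal.mem_span_singleton'.1 (hPx hy)
      have ha : a ∈ P := (hPp.mem_or_mem hy).resolve_right (hxp P hP)
      rw [mul_comm]
      exact Ideal.mul_mem_mul hx ha
    have hbp : (⊥ : Ideal R).IsPrime := hPbot ▸ hPp
    exact IsDomain.of_bot_isPrime R

/-- Let `(R, m)` be a complete Noetherian local ring and `(S, n)` a Noetherian regular
local ring with a local homomorphism `φ : R → S`. Then `φ` is an isomorphism iff both
induced maps `R/m → S/n` and `m/m² → n/n²` are isomorphisms. -/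
theorem stmt_12 {R S : Type*} [CommRing R] [IsLocalRing R] [IsNoetherianRing R]
    [CommRing S] [IsLocalRing S]
    (hcomplete : IsAdicComplete (maximalIdeal R) R)
    (hreg : IsRegularLocalRingP S)
    (phi : R →+* S) [IsLocalHom phi] :
    Function.Bijective phi ↔
      Function.Bijective (ResidueField.map phi) ∧ Function.Bijective (cotangentMapOf phi) := by
  have hN : IsNoetherianRing S := hreg.1
  have hdimS : ringKrullDim S = ((maximalIdeal S).spanFinrank : WithBot ℕ∞) := by
    rw [hreg.2, spanFinrank_maximalIdeal_eq_finrank_cotangentSpace]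
  have hloc : ∀ x ∈ maximalIdeal R, phi x ∈ maximalIdeal S := fun x hx =>
    fun hu => hx (IsLocalHom.map_nonunit (f := phi) x hu)
  have hcot : ∀ x (hx : x ∈ maximalIdeal R),
      cotangentMapOf phi ((maximalIdeal R).toCotangent ⟨x, hx⟩) =
        (maximalIdeal S).toCotangent ⟨phi x, hloc x hx⟩ := fun x hx => rfl
  constructor
  · intro hb
    have hmap := map_maximalIdeal_of_surjective phi hb.2
    refine ⟨⟨RingHom.injective _, ?_⟩, ?_, ?_⟩
    · intro y
      obtain ⟨y, rfl⟩ := residue_surjective y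
      obtain ⟨x, rfl⟩ := hb.2 y
      exact ⟨residue R x, ResidueField.map_residue phi x⟩
    · rw [injective_iff_map_eq_zero]
      intro c hc
      obtain ⟨⟨x, hx⟩, rfl⟩ := Ideal.toCotangent_surjective _ c
      rw [hcot, Ideal.toCotangent_eq_zero] at hc
      rw [Ideal.toCotangent_eq_zero]
      change phi x ∈ _ at hc
      rw [← hmap, ← Ideal.map_pow] at hc
      obtain ⟨z, hz, hzx⟩ := (Ideal.mem_map_iff_of_surjective phi hb.2).1 hc
      exact hb.1 hzx ▸ hz
    · intro c
      obtain ⟨⟨y, hy⟩, rfl⟩ := Ideal.toCotangent_surjective _ c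
      rw [← hmap] at hy
      obtain ⟨z, hz, rfl⟩ := (Ideal.mem_map_iff_of_surjective phi hb.2).1 hy
      exact ⟨_, hcot z hz⟩
  · rintro ⟨hres, hci, hcs⟩
    have hmap : Ideal.map phi (maximalIdeal R) = maximalIdeal S := by
      apply le_antisymm (Ideal.map_le_iff_le_comap.2 hloc)
      refine Submodule.le_of_le_smul_of_le_jacobson_bot (I := maximalIdeal S)
        (IsNoetherian.noetherian _) (maximalIdeal_le_jacobson _) ?_
      intro y hy
      obtain ⟨c, hc⟩ := hcs ((maximalIdeal S).toCotangent ⟨y, hy⟩)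
      obtain ⟨⟨x, hx⟩, rfl⟩ := Ideal.toCotangent_surjective _ c
      rw [hcot, eq_comm, Ideal.toCotangent_eq] at hc
      have : y = phi x + (y - phi x) := by ring
      rw [this]
      refine add_mem (Ideal.mem_sup_left (Ideal.mem_map_of_mem _ hx)) (Ideal.mem_sup_right ?_)
      rw [smul_eq_mul, ← pow_two]
      exact hc
    have hsurj : Function.Surjective phi := by
      have : IsHausdorff (Ideal.map phi (maximalIdeal R)) S := by
        rw [hmap]; infer_instance
      apply surjective_of_mk_map_comp_surjective (I := maximalIdeal R) phi
      intro y
      obtain ⟨y, rfl⟩ := Ideal.Quotient.mk_surjective y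
      obtain ⟨r, hr⟩ := hres.2 (residue S y)
      obtain ⟨x, rfl⟩ := residue_surjective r
      rw [ResidueField.map_residue] at hr
      refine ⟨x, ?_⟩
      rw [RingHom.comp_apply, Ideal.Quotient.eq, hmap]
      exact Ideal.Quotient.eq.1 hr
    have hker : ∀ x, phi x = 0 → x ∈ maximalIdeal R ^ 2 := by
      intro x hx
      have hxm : x ∈ maximalIdeal R := fun hu => by
        have := hu.map phi
        rw [hx] at this
        exact not_isUnit_zero this
      rw [← Ideal.toCotangent_eq_zero _ ⟨x, hxm⟩]
      apply (injective_iff_map_eq_zero _).1 hci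
      rw [hcot, Ideal.toCotangent_eq_zero]
      simp [hx]
    obtain ⟨s, hsc, hs⟩ := Submodule.FG.exists_span_finset_card_eq_spanFinrank
      (IsNoetherian.noetherian (maximalIdeal S))
    classical
    choose g hg using hsurj
    have hJ : Ideal.span ((s.image g : Finset R) : Set R) = maximalIdeal R := by
      have himg : phi '' ((s.image g : Finset R) : Set R) = s := by
        rw [Finset.coe_image, Set.image_image]; simp [hg]
      have hJm : Ideal.span ((s.image g : Finset R) : Set R) ≤ maximalIdeal R := by
        rw [Ideal.span_le]
        intro a ha
        rw [Finset.coe_image] at ha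
        obtain ⟨b, hb, rfl⟩ := ha
        have : b ∈ maximalIdeal S := by rw [← hs]; exact Submodule.subset_span hb
        intro hu
        have := hu.map phi
        rw [hg] at this
        exact (mem_maximalIdeal _).1 ‹_› this
      apply le_antisymm hJm
      refine Submodule.le_of_le_smul_of_le_jacobson_bot (I := maximalIdeal R)
        (IsNoetherian.noetherian _) (maximalIdeal_le_jacobson _) ?_
      intro x hx
      have h1 : phi x ∈ Ideal.map phi (Ideal.span ((s.image g : Finset R) : Set R)) := by
        rw [Ideal.map_span, himg]
        have := hloc x hx
        rw [← hs] at this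
        exact this
      obtain ⟨z, hz, hzx⟩ := (Ideal.mem_map_iff_of_surjective phi (fun y => ⟨g y, hg y⟩)).1 h1
      have : x = z + (x - z) := by ring
      rw [this]
      refine add_mem (Ideal.mem_sup_left hz) (Ideal.mem_sup_right ?_)
      rw [smul_eq_mul, ← pow_two]
      exact hker _ (by rw [map_sub, hzx, sub_self])
    have hcard : (s.image g).card = s.card :=
      Finset.card_image_of_injective _ (Function.LeftInverse.injective hg)
    have hsurj : Function.Surjective phi := fun y => ⟨g y, hg y⟩
    have hle : ringKrullDim S ≤ ringKrullDim R := ringKrullDim_le_of_surjective phi hsurj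
    have hR : ringKrullDim R ≤ (s.card : WithBot ℕ∞) := by
      refine (ringKrullDim_le_spanFinrank_maximalIdeal R).trans ?_
      rw [← hJ, ← hcard]
      have := Submodule.spanFinrank_span_le_ncard_of_finite (R := R)
        (s := ((s.image g : Finset R) : Set R)) (Finset.finite_toSet _)
      rw [Set.ncard_coe_finset] at this
      exact_mod_cast this
    have hdom : IsDomain R := aux_domain s.card R (s.image g) hJ hcard (by
      rw [hsc, ← hdimS]; exact hle)
    refine ⟨?_, hsurj⟩
    rw [injective_iff_map_eq_zero]
    intro x hx
    by_contra hx0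
    have h := (ringKrullDim_succ_le_of_surjective phi hsurj
      (mem_nonZeroDivisors_of_ne_zero hx0) hx).trans hR
    rw [hdimS, ← hsc] at h
    have h' : ((s.card + 1 : ℕ) : WithBot ℕ∞) ≤ (s.card : WithBot ℕ∞) := by exact_mod_cast h
    have := Nat.cast_le.1 h'
    omega
end

section
/- (Generic freeness.) Let R be a Noetherian integral domain, A a finitely generated R-algebra and M a finitely generated A-module. Then there exists a nonzero element f of R such that the localization M_f is a free module over R_f. -/
universe uR uB uC uM

/-- `GFGood f M`: up to `f`-power torsion, `M` is free over `R` on a subset. -/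
def GFGood {R : Type uR} {M : Type uM} [CommRing R] [AddCommGroup M] [Module R M]
    (f : R) (N : Submodule R M) (s : Set M) : Prop :=
  s ⊆ N ∧ LinearIndepOn R id s ∧ ∀ m ∈ N, ∃ n : ℕ, f ^ n • m ∈ Submodule.span R s

theorem GFGood.of_dvd {R : Type uR} {M : Type uM} [CommRing R] [AddCommGroup M] [Module R M]
    {f g : R} {N : Submodule R M} {s : Set M} (h : GFGood f N s) (hfg : f ∣ g) :
    GFGood g N s := by
  refine ⟨h.1, h.2.1, fun m hm => ?_⟩
  obtain ⟨n, hn⟩ := h.2.2 m hm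
  obtain ⟨c, rfl⟩ := hfg
  refine ⟨n, ?_⟩
  rw [mul_pow, mul_comm, mul_smul]
  exact Submodule.smul_mem _ _ hn

theorem GFGood.extend {R : Type uR} {M P Q : Type uM} [CommRing R] [AddCommGroup M] [Module R M]
    [AddCommGroup P] [Module R P] [AddCommGroup Q] [Module R Q]
    {f : R} {N : Submodule R M} {s : Set M} (h : GFGood f N s)
    (g : P →ₗ[R] M) (q : P →ₗ[R] Q) (hq : Function.Surjective q)
    (hqg : ∀ p, q p = 0 ↔ g p ∈ N) {t : Set Q} (ht : GFGood f ⊤ t) :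
    ∃ s', s ⊆ s' ∧ GFGood f (N ⊔ LinearMap.range g) s' := by
  obtain ⟨sec, hsec⟩ := hq.hasRightInverse
  have hqs : q ∘ sec = id := funext hsec
  refine ⟨s ∪ (g ∘ sec) '' t, Set.subset_union_left, ?_, ?_, ?_⟩
  · rintro x (hx | ⟨y, hy, rfl⟩)
    · exact Submodule.mem_sup_left (h.1 hx)
    · exact Submodule.mem_sup_right ⟨_, rfl⟩
  · refine LinearIndepOn.union_id_of_quotient (M' := N) h.1 h.2.1 ?_
    apply LinearIndepOn.image_of_comp
    have h1 : LinearIndepOn R (q ∘ sec) t := by rw [hqs]; exact ht.2.1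
    have h2 : LinearIndependent R (fun i : t => sec i) := LinearIndependent.of_comp q h1
    have h3 := Submodule.range_ker_disjoint (f := q) (v := fun i : t => sec i) h1
    have h4 : LinearMap.ker q = LinearMap.ker (N.mkQ ∘ₗ g) := by
      ext p; simp [hqg]
    rw [h4] at h3
    exact h2.map h3
  · intro m hm
    obtain ⟨a, ha, _, ⟨p, rfl⟩, rfl⟩ := Submodule.mem_sup.1 hm
    obtain ⟨n, hn⟩ := ht.2.2 (q p) trivial
    have hspan : Submodule.span R t = (Submodule.span R (sec '' t)).map q := by
      rw [Submodule.map_span, ← Set.image_comp, hqs, Set.image_id]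
    rw [hspan] at hn
    obtain ⟨y, hy, hyq⟩ := hn
    have hN : g (f ^ n • p - y) ∈ N := by
      rw [← hqg, map_sub, map_smul, hyq, sub_self]
    obtain ⟨k, hk⟩ := h.2.2 _ hN
    obtain ⟨j, hj⟩ := h.2.2 _ ha
    have hgy : g y ∈ Submodule.span R ((g ∘ sec) '' t) := by
      rw [Set.image_comp, ← Submodule.map_span]
      exact ⟨y, hy, rfl⟩
    refine ⟨n + k + j, ?_⟩
    have hs := Submodule.span_mono (R := R) (Set.subset_union_left (s := s) (t := (g ∘ sec) '' t))
    have ht' := Submodule.span_mono (R := R) (Set.subset_union_right (s := s) (t := (g ∘ sec) '' t))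
    have e : f ^ (n + k + j) • (a + g p) = f ^ (n + k) • (f ^ j • a)
        + f ^ j • (f ^ k • g (f ^ n • p - y)) + f ^ (j + k) • g y := by
      simp only [map_sub, map_smul]
      module
    rw [e]
    exact add_mem (add_mem (Submodule.smul_mem _ _ (hs hj)) (Submodule.smul_mem _ _ (hs hk)))
      (Submodule.smul_mem _ _ (ht' hgy))

theorem GFGood.chain {R : Type uR} {M : Type uM} [CommRing R] [AddCommGroup M] [Module R M]
    {f : R} (F : ℕ → Submodule R M) (h0 : F 0 = ⊥)
    (hstep : ∀ k s, GFGood f (F k) s → ∃ s', s ⊆ s' ∧ GFGood f (F (k + 1)) s')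
    (hU : ∀ m, ∃ k, m ∈ F k) : ∃ s, GFGood f (⊤ : Submodule R M) s := by
  classical
  choose! nxt hn1 hn2 using hstep
  let T : ℕ → Set M := fun k => Nat.rec ∅ (fun k s => nxt k s) k
  have hT : ∀ k, GFGood f (F k) (T k) := by
    intro k
    induction k with
    | zero =>
      refine ⟨by simp [T], by simp [T], fun m hm => ⟨0, ?_⟩⟩
      rw [h0, Submodule.mem_bot] at hm
      simp [hm]
    | succ k ih => exact hn2 k _ ih
  have hmono : Monotone T := monotone_nat_of_le_succ fun k => hn1 k _ (hT k)
  refine ⟨⋃ k, T k, fun _ _ => trivial, ?_, ?_⟩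
  · exact linearIndepOn_iUnion_of_directed hmono.directed_le fun k => (hT k).2.1
  · intro m _
    obtain ⟨k, hk⟩ := hU m
    obtain ⟨n, hn⟩ := (hT k).2.2 m hk
    exact ⟨n, Submodule.span_mono (Set.subset_iUnion T k) hn⟩

/-- Generic freeness for all finite modules over the `R`-algebra `B`. -/
def GF (R : Type uR) (B : Type uB) [CommRing R] [CommRing B] [Algebra R B] : Prop :=
  ∀ (M : Type uM) [AddCommGroup M] [Module R M] [Module B M] [IsScalarTower R B M]
    [Module.Finite B M], ∃ f : R, f ≠ 0 ∧ ∃ s : Set M, GFGood f ⊤ s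

theorem GF.base (R : Type uR) [CommRing R] [IsDomain R] : GF.{uR, uR, uM} R R := by
  intro M _ i1 i2 i3 hfin
  have heq : i1 = i2 := by
    refine Module.ext' _ _ fun a x => ?_
    have := i3.smul_assoc a 1 x
    rw [smul_eq_mul, mul_one, i2.one_smul] at this
    exact this.symm
  subst heq
  obtain ⟨s, hs, hmax⟩ := exists_maximal_linearIndepOn R (id : M → M)
  have hall : ∀ m : M, ∃ a : R, a ≠ 0 ∧ a • m ∈ Submodule.span R s := by
    intro m
    by_cases hm : m ∈ s
    · exact ⟨1, one_ne_zero, by simpa using Submodule.subset_span hm⟩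
    · simpa using hmax m hm
  choose a ha0 ha using hall
  obtain ⟨S, hS⟩ := hfin
  refine ⟨∏ m ∈ S, a m, Finset.prod_ne_zero_iff.2 fun m _ => ha0 m, s, fun _ _ => trivial, hs, ?_⟩
  intro m _
  refine ⟨1, ?_⟩
  rw [pow_one]
  have hm : m ∈ Submodule.span R (S : Set M) := hS ▸ trivial
  induction hm using Submodule.span_induction with
  | mem x hx =>
    obtain ⟨c, hc⟩ := Finset.dvd_prod_of_mem a hx
    rw [hc, mul_comm, mul_smul]
    exact Submodule.smul_mem _ _ (ha x)
  | zero => simp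
  | add x y _ _ hx hy => rw [smul_add]; exact add_mem (hx trivial) (hy trivial)
  | smul c x _ hx => rw [smul_comm]; exact Submodule.smul_mem _ _ (hx trivial)

theorem GF.surj {R : Type uR} {B : Type uB} {C : Type uC} [CommRing R] [CommRing B] [Algebra R B]
    [CommRing C] [Algebra R C] (φ : B →ₐ[R] C) (hφ : Function.Surjective φ)
    (h : GF.{uR, uB, uM} R B) : GF.{uR, uC, uM} R C := by
  intro M _ _ _ _ _
  let _ : Module B M := Module.compHom M φ.toRingHom
  have hsm : ∀ (b : B) (m : M), b • m = φ b • m := fun _ _ => rfl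
  have : IsScalarTower R B M := ⟨fun r b m => by rw [hsm, hsm, map_smul, smul_assoc]⟩
  have : Module.Finite B M := by
    obtain ⟨S, hS⟩ := ‹Module.Finite C M›
    refine ⟨S, top_unique fun x _ => ?_⟩
    have hx : x ∈ Submodule.span C (S : Set M) := hS ▸ trivial
    induction hx using Submodule.span_induction with
    | mem x hx => exact Submodule.subset_span hx
    | zero => exact zero_mem _
    | add x y _ _ hx hy => exact add_mem (hx trivial) (hy trivial)
    | smul c x _ hx =>
      obtain ⟨b, rfl⟩ := hφ c
      exact Submodule.smul_mem _ b (hx trivial)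
  exact h M

theorem GFGood.extendB {R : Type uR} {B : Type uB} {M P : Type uM} [CommRing R] [CommRing B]
    [Algebra R B] [AddCommGroup M] [Module R M] [Module B M] [IsScalarTower R B M]
    [AddCommGroup P] [Module R P] [Module B P] [IsScalarTower R B P]
    {f : R} (N : Submodule B M) (g : P →ₗ[B] M) {s : Set M}
    (hs : GFGood f (N.restrictScalars R) s) {t : Set (P ⧸ N.comap g)}
    (ht : GFGood f (⊤ : Submodule R _) t) :
    ∃ s', s ⊆ s' ∧ GFGood f ((N ⊔ LinearMap.range g).restrictScalars R) s' := by
  have hq : Function.Surjective ((N.comap g).mkQ.restrictScalars R) := fun y => by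
    obtain ⟨p, hp⟩ := (N.comap g).mkQ_surjective y
    exact ⟨p, hp⟩
  have hqg : ∀ p, (N.comap g).mkQ.restrictScalars R p = 0 ↔
      g.restrictScalars R p ∈ N.restrictScalars R := fun p => by
    rw [LinearMap.restrictScalars_apply, Submodule.mkQ_apply, Submodule.Quotient.mk_eq_zero]
    exact Iff.rfl
  obtain ⟨s', h1, h2⟩ := GFGood.extend hs (g.restrictScalars R) _ hq hqg ht
  refine ⟨s', h1, ?_⟩
  convert h2 using 1
  ext m
  simp only [Submodule.restrictScalars_mem, Submodule.mem_sup, LinearMap.mem_range,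
    LinearMap.coe_restrictScalars]

open Polynomial in
theorem GF.poly {R : Type uR} {B : Type uB} [CommRing R] [IsDomain R] [CommRing B] [Algebra R B]
    [IsNoetherianRing B] (h : GF.{uR, uB, uM} R B) : GF.{uR, uB, uM} R B[X] := by
  intro M _ _ _ _ _
  let _ : Module B M := Module.compHom M (C : B →+* B[X])
  have hsm : ∀ (b : B) (m : M), b • m = (C b : B[X]) • m := fun _ _ => rfl
  have : IsScalarTower R B M := ⟨fun r b m => by
    rw [hsm, hsm, ← Polynomial.smul_C, smul_assoc]⟩
  obtain ⟨S, hS⟩ := ‹Module.Finite B[X] M›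
  let M₀ : Submodule B M := Submodule.span B (S : Set M)
  have : Module.Finite B M₀ := Module.Finite.span_finset B S
  have : IsNoetherian B M₀ := isNoetherian_of_isNoetherianRing_of_finite B M₀
  let x : M →ₗ[B] M :=
    { toFun := fun m => (X : B[X]) • m
      map_add' := fun a b => smul_add _ _ _
      map_smul' := fun b m => by
        simp only [hsm, RingHom.id_apply, smul_smul, mul_comm] }
  let g : ℕ → (M₀ →ₗ[B] M) := fun k => (x ^ k) ∘ₗ M₀.subtype
  let F : ℕ → Submodule B M := fun k => Nat.rec ⊥ (fun k N => N ⊔ LinearMap.range (g k)) k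
  have hFs : ∀ k, F (k + 1) = F k ⊔ LinearMap.range (g k) := fun k => rfl
  have hgs : ∀ k p, g (k + 1) p = x (g k p) := fun k p => by
    simp [g, pow_succ']
  have hFx : ∀ k, ∀ m ∈ F k, x m ∈ F (k + 1) := by
    intro k
    induction k with
    | zero =>
      intro m hm
      have : m = 0 := by simpa [F] using hm
      rw [this, map_zero]; exact zero_mem _
    | succ k ih =>
      intro m hm
      rw [hFs] at hm
      obtain ⟨a, ha, _, ⟨p, rfl⟩, rfl⟩ := Submodule.mem_sup.1 hm
      rw [map_add, ← hgs, hFs (k + 1)]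
      exact add_mem (Submodule.mem_sup_left (ih _ ha)) (Submodule.mem_sup_right ⟨_, rfl⟩)
  have hFmono : Monotone F := monotone_nat_of_le_succ fun k => by rw [hFs]; exact le_sup_left
  let K : ℕ →o Submodule B M₀ := ⟨fun k => (F k).comap (g k), monotone_nat_of_le_succ fun k p hp => by
    simp only [Submodule.mem_comap] at hp ⊢
    rw [hgs]; exact hFx k _ hp⟩
  obtain ⟨n, hn⟩ := monotone_stabilizes_iff_noetherian.2 ‹IsNoetherian B M₀› K
  have hex : ∀ k, ∃ f : R, f ≠ 0 ∧ ∃ s : Set (M₀ ⧸ K k), GFGood f (⊤ : Submodule R _) s :=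
    fun k => h (M₀ ⧸ K k)
  choose f hf0 hf using hex
  let f' : R := ∏ k ∈ Finset.range (n + 1), f k
  have hgood : ∀ k, ∃ s : Set (M₀ ⧸ K k), GFGood f' (⊤ : Submodule R _) s := by
    have key : ∀ k ≤ n, ∃ s : Set (M₀ ⧸ K k), GFGood f' (⊤ : Submodule R _) s := by
      intro k hk
      obtain ⟨s, hs⟩ := hf k
      exact ⟨s, hs.of_dvd (Finset.dvd_prod_of_mem f (Finset.mem_range.2 (by omega)))⟩
    intro k
    rcases le_total k n with hk | hk
    · exact key k hk
    · rw [← hn k hk]; exact key n le_rfl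
  refine ⟨f', Finset.prod_ne_zero_iff.2 fun k _ => hf0 k, ?_⟩
  apply GFGood.chain (fun k => (F k).restrictScalars R)
  · rfl
  · intro k s hs
    obtain ⟨t, ht⟩ := hgood k
    exact GFGood.extendB (F k) (g k) hs ht
  · intro m
    have hm : m ∈ Submodule.span B[X] (S : Set M) := hS ▸ trivial
    induction hm using Submodule.span_induction with
    | mem y hy =>
      refine ⟨1, Submodule.mem_sup_right ⟨⟨y, Submodule.subset_span hy⟩, ?_⟩⟩
      simp [g]
    | zero => exact ⟨0, zero_mem _⟩
    | add y z _ _ hy hz =>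
      obtain ⟨i, hi⟩ := hy
      obtain ⟨j, hj⟩ := hz
      exact ⟨max i j, add_mem (hFmono (le_max_left i j) hi) (hFmono (le_max_right i j) hj)⟩
    | smul p y _ hy =>
      induction p using Polynomial.induction_on' with
      | add p q hp hq =>
        obtain ⟨i, hi⟩ := hp
        obtain ⟨j, hj⟩ := hq
        rw [add_smul]
        exact ⟨max i j, add_mem (hFmono (le_max_left i j) hi) (hFmono (le_max_right i j) hj)⟩
      | monomial d b =>
        obtain ⟨i, hi⟩ := hy
        have hx : ∀ d : ℕ, (X ^ d : B[X]) • y ∈ F (i + d) := by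
          intro d
          induction d with
          | zero => simpa using hi
          | succ d ih =>
            rw [pow_succ', mul_smul]
            exact hFx _ _ ih
        refine ⟨i + d, ?_⟩
        rw [← C_mul_X_pow_eq_monomial, mul_smul]
        exact Submodule.smul_mem (F (i + d)) b (hx d)

theorem GF.mvPoly (R : Type uR) [CommRing R] [IsDomain R] [IsNoetherianRing R] (n : ℕ) :
    GF.{uR, uR, uM} R (MvPolynomial (Fin n) R) := by
  induction n with
  | zero =>
    exact (GF.base R).surj (MvPolynomial.isEmptyAlgEquiv R (Fin 0)).symm.toAlgHom
      (MvPolynomial.isEmptyAlgEquiv R (Fin 0)).symm.surjective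
  | succ n ih =>
    exact ih.poly.surj (MvPolynomial.finSuccEquiv R n).symm.toAlgHom
      (MvPolynomial.finSuccEquiv R n).symm.surjective

theorem GFGood.free {R : Type uR} {M : Type uM} [CommRing R] [AddCommGroup M] [Module R M]
    {f : R} {s : Set M} (h : GFGood f ⊤ s) :
    Module.Free (Localization.Away f) (LocalizedModule (Submonoid.powers f) M) := by
  let l := LocalizedModule.mkLinearMap (Submonoid.powers f) M
  have hli : LinearIndependent R (fun i : s => (i : M)) := h.2.1
  have hli' := hli.of_isLocalizedModule (Localization.Away f) (Submonoid.powers f) l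
  refine Module.Free.of_basis (Module.Basis.mk hli' ?_)
  intro z _
  induction z using LocalizedModule.induction_on with
  | h m t =>
  obtain ⟨n, hn⟩ := h.2.2 m trivial
  have h1 : l (f ^ n • m) ∈ Submodule.span (Localization.Away f)
      (Set.range (l ∘ fun i : s => (i : M))) := by
    apply Submodule.span_subset_span R
    rw [Set.range_comp, Subtype.range_coe, ← Submodule.map_span]
    exact ⟨_, hn, rfl⟩
  let u : Submonoid.powers f := ⟨f ^ n, n, rfl⟩
  have h2 : LocalizedModule.mk m t = (Localization.mk 1 (u * t) : Localization.Away f)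
      • l (f ^ n • m) := by
    simp only [l, LocalizedModule.mkLinearMap_apply, LocalizedModule.mk_smul_mk, one_smul, mul_one]
    exact (LocalizedModule.mk_cancel_common_left u t m).symm
  rw [h2]
  exact Submodule.smul_mem _ _ h1



/-- Generic freeness: Let `R` be a Noetherian integral domain, `A` a finitely generated
`R`-algebra and `M` a finitely generated `A`-module. Then there exists a nonzero `f : R`
such that the localization `M_f` is a free module over `R_f`. -/
theorem stmt_13 (R A M : Type*) [CommRing R] [IsDomain R] [IsNoetherianRing R]
    [CommRing A] [Algebra R A] [Algebra.FiniteType R A]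
    [AddCommGroup M] [Module R M] [Module A M] [IsScalarTower R A M]
    [Module.Finite A M] :
    ∃ f : R, f ≠ 0 ∧
      Module.Free (Localization.Away f) (LocalizedModule (Submonoid.powers f) M) := by
  obtain ⟨n, φ, hφ⟩ := Algebra.FiniteType.iff_quotient_mvPolynomial''.1 ‹Algebra.FiniteType R A›
  obtain ⟨f, hf, s, hs⟩ := (GF.mvPoly R n).surj φ hφ M
  exact ⟨f, hf, hs.free⟩
end
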